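/- Fix ν ∈ {0,1} and a sequence (κ_n)_{n≥1} of complex numbers with Σ_n |κ_n|² < ∞, and set ξ_n = π²(n − 1/2 + κ_n)² for n ≥ 1. Assume all repetitions among the ξ_n are neighboring, i.e. whenever ξ_n takes a value with multiplicity m_n, it equals ξ_{n} = ξ_{n+1} = … = ξ_{n+m_n−1}; let S = {1} ∪ {n ≥ 2 : ξ_n ≠ ξ_{n−1}} index the distinct values and m_k (finite) the multiplicity of ξ_k for k ∈ S. Define functions s_n ∈ L²((0,1),ℂ) by s_{k+s}(x) = k^{1−ν} (∂^s/∂λ^s) S_ν(x,λ) evaluated at λ = ξ_k, for k ∈ S and s = 0,…,m_k−1. Then the system (s_n)_{n≥1} is a Riesz basis of L²((0,1),ℂ): there exist an orthonormal (Hilbert) basis (e_n)_{n≥1} of L²((0,1),ℂ) and a continuous linear equivalence T : L²((0,1),ℂ) → L²((0,1),ℂ) (bounded with bounded inverse) such that T e_n = s_n for all n. -/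

import Mathlib

open MeasureTheory Real Set

/-- `S_ν(x,λ)` as an entire function of `λ`: for `λ = ρ²`,
`S_0(x,λ) = sin(ρx)/ρ = ∑ (−1)^k λ^k x^{2k+1}/(2k+1)!` and
`S_1(x,λ) = cos(ρx) = ∑ (−1)^k λ^k x^{2k}/(2k)!`. -/
noncomputable def Slam (ν : ℕ) (x : ℝ) (lam : ℂ) : ℂ :=
  if ν = 0 then
    ∑' k : ℕ, (-1) ^ k * lam ^ k * (x : ℂ) ^ (2 * k + 1) / (Nat.factorial (2 * k + 1) : ℂ)
  else
    ∑' k : ℕ, (-1) ^ k * lam ^ k * (x : ℂ) ^ (2 * k) / (Nat.factorial (2 * k) : ℂ)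

section HilbertSpace

open scoped InnerProductSpace

variable {ι H : Type*} [NormedAddCommGroup H] [InnerProductSpace ℂ H]

theorem HilbertBasis.hasSum_norm_inner_sq (e : HilbertBasis ι ℂ H) (x : H) :
    HasSum (fun i => ‖⟪e i, x⟫_ℂ‖ ^ 2) (‖x‖ ^ 2) := by
  have h := e.hasSum_inner_mul_inner x x
  have h' := Complex.hasSum_re h
  convert h' using 1
  · ext i
    rw [← inner_conj_symm x (e i), ← Complex.normSq_eq_conj_mul_self, Complex.ofReal_re,
      Complex.normSq_eq_norm_sq]
  · exact (inner_self_eq_norm_sq (𝕜 := ℂ) x).symm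

theorem norm_inner_sq_le (w f : H) : ‖⟪w, f⟫_ℂ‖ ^ 2 ≤ ‖w‖ ^ 2 * ‖f‖ ^ 2 := by
  rw [← mul_pow]
  gcongr
  exact norm_inner_le_norm w f

theorem HilbertBasis.norm_sq_le_of_inner_eq (e : HilbertBasis ι ℂ H) {w : ι → H}
    (hw : Summable fun i => ‖w i‖ ^ 2) {f g : H} (h : ∀ i, ‖⟪e i, g⟫_ℂ‖ = ‖⟪w i, f⟫_ℂ‖) :
    ‖g‖ ^ 2 ≤ (∑' i, ‖w i‖ ^ 2) * ‖f‖ ^ 2 := by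
  refine hasSum_le (fun i => ?_) (e.hasSum_norm_inner_sq g) (hw.hasSum.mul_right _)
  rw [h]
  exact norm_inner_sq_le _ _

theorem HilbertBasis.exists_analysis_operator (e : HilbertBasis ι ℂ H) {w : ι → H}
    (hw : Summable fun i => ‖w i‖ ^ 2) :
    ∃ K : H →L[ℂ] H, ∀ i f, ⟪e i, K f⟫_ℂ = ⟪w i, f⟫_ℂ := by
  have hmem : ∀ f, Memℓp (fun i => ⟪w i, f⟫_ℂ) 2 := fun f => by
    refine memℓp_gen ?_
    simp only [ENNReal.toReal_ofNat, Real.rpow_ofNat]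
    exact Summable.of_nonneg_of_le (fun _ => by positivity) (fun i => norm_inner_sq_le _ _)
      (hw.mul_right (‖f‖ ^ 2))
  let L : H →ₗ[ℂ] H :=
    { toFun := fun f => e.repr.symm ⟨_, hmem f⟩
      map_add' := fun f g => by
        rw [← map_add]
        congr 1
        ext i
        simp only [inner_add_right]
        rfl
      map_smul' := fun a f => by
        rw [RingHom.id_apply, ← map_smul]
        congr 1
        ext i
        simp }
  have hL : ∀ i f, ⟪e i, L f⟫_ℂ = ⟪w i, f⟫_ℂ := fun i f => by
    rw [← e.repr_apply_apply]
    simp [L]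
  refine ⟨L.mkContinuous (√(∑' i, ‖w i‖ ^ 2)) fun f => ?_, hL⟩
  refine le_of_sq_le_sq ?_ (by positivity)
  rw [mul_pow, Real.sq_sqrt (tsum_nonneg fun _ => by positivity)]
  exact e.norm_sq_le_of_inner_eq hw fun i => by rw [hL]

theorem HilbertBasis.isCompactOperator_of_inner_eq (e : HilbertBasis ι ℂ H) {w : ι → H}
    (hw : Summable fun i => ‖w i‖ ^ 2) [CompleteSpace H] {K : H →L[ℂ] H}
    (hK : ∀ i f, ⟪e i, K f⟫_ℂ = ⟪w i, f⟫_ℂ) : IsCompactOperator K := by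
  classical
  let R : Finset ι → H →L[ℂ] H := fun F =>
    ∑ i ∈ F, (ContinuousLinearMap.toSpanSingleton ℂ (e i)).comp (innerSL ℂ (w i))
  have hR : ∀ F i f, ⟪e i, (K - R F) f⟫_ℂ = ⟪if i ∈ F then 0 else w i, f⟫_ℂ := fun F i f => by
    have he := orthonormal_iff_ite.1 e.orthonormal
    simp only [sub_apply, inner_sub_right, hK, R,
      sum_apply, inner_sum, ContinuousLinearMap.comp_apply,
      ContinuousLinearMap.toSpanSingleton_apply, inner_smul_right, innerSL_apply_apply, he]
    split_ifs with h <;> simp [h]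
  have hbound : ∀ F, ‖K - R F‖ ≤ √(∑' i, ‖if i ∈ F then 0 else w i‖ ^ 2) := fun F => by
    refine ContinuousLinearMap.opNorm_le_bound _ (by positivity) fun f => ?_
    refine le_of_sq_le_sq ?_ (by positivity)
    rw [mul_pow, Real.sq_sqrt (tsum_nonneg fun _ => by positivity)]
    refine e.norm_sq_le_of_inner_eq ?_ fun i => by rw [hR]
    refine Summable.of_nonneg_of_le (fun _ => by positivity) (fun i => ?_) hw
    split_ifs <;> simp
  have htail : Filter.Tendsto (fun F : Finset ι => ∑' i, ‖if i ∈ F then 0 else w i‖ ^ 2)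
      Filter.atTop (nhds 0) := by
    have h := tendsto_tsum_compl_atTop_zero fun i => ‖w i‖ ^ 2
    refine h.congr fun F => ?_
    refine (tsum_subtype {x | x ∉ F} fun i => ‖w i‖ ^ 2).trans ?_
    congr 1 with i
    by_cases hi : i ∈ F <;> simp [hi]
  refine isCompactOperator_of_tendsto (F := R) (l := Filter.atTop) ?_ (.of_forall fun F => ?_)
  · rw [tendsto_iff_norm_sub_tendsto_zero]
    refine squeeze_zero (fun _ => norm_nonneg _) (fun F => ?_)
      (by simpa using htail.sqrt)
    rw [norm_sub_rev]
    exact hbound F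
  · have : ∀ F : Finset ι, R F ∈ compactOperator (RingHom.id ℂ) H H := fun F => by
      refine Submodule.sum_mem _ fun i _ => ?_
      have h : IsCompactOperator (innerSL ℂ (w i)) :=
        isCompactOperator_of_locallyCompactSpace_dom (innerSL ℂ (w i))
      exact h.clm_comp (ContinuousLinearMap.toSpanSingleton ℂ (e i))
    exact this F

/-- A complete system quadratically close to a multiple of a Hilbert basis is a Riesz basis. -/
theorem HilbertBasis.exists_equiv_of_summable_norm_sub_sq [CompleteSpace H]
    (e : HilbertBasis ι ℂ H) {v : ι → H} {c : ℂ} (hc : c ≠ 0)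
    (hv : Summable fun i => ‖v i - c • e i‖ ^ 2)
    (hcomplete : ∀ f, (∀ i, ⟪v i, f⟫_ℂ = 0) → f = 0) :
    ∃ T : H ≃L[ℂ] H, ∀ i, T (e i) = v i := by
  obtain ⟨K, hK⟩ := e.exists_analysis_operator hv
  set d : ℂ := -(starRingEnd ℂ c) with hd
  have hd0 : d ≠ 0 := by simpa [hd] using hc
  have hA : ∀ i f, ⟪e i, (K - d • (1 : H →L[ℂ] H)) f⟫_ℂ = ⟪v i, f⟫_ℂ := fun i f => by
    simp [hK, hd]
    ring
  have hunit : IsUnit (K - d • (1 : H →L[ℂ] H)) := by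
    rcases (e.isCompactOperator_of_inner_eq hv hK).hasEigenvalue_or_mem_resolventSet hd0 with h | h
    · obtain ⟨f, hf⟩ := h.exists_hasEigenvector
      refine absurd (hcomplete f fun i => ?_) hf.2
      rw [← hA]
      have : K f = d • f := hf.apply_eq_smul
      simp [this]
    · have := (spectrum.mem_resolventSet_iff.1 h).neg
      rwa [neg_sub, Algebra.algebraMap_eq_smul_one] at this
  obtain ⟨u, hu⟩ := isUnit_star.2 hunit
  refine ⟨ContinuousLinearEquiv.ofUnit u, fun i => ext_inner_right ℂ fun f => ?_⟩
  change ⟪(u : H →L[ℂ] H) (e i), f⟫_ℂ = _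
  rw [hu, ContinuousLinearMap.star_eq_adjoint, ContinuousLinearMap.adjoint_inner_left, hA]

end HilbertSpace

section Slam

theorem Slam_eq_tsum (ν : ℕ) (x : ℝ) (lam : ℂ) :
    Slam ν x lam = ∑' k : ℕ, lam ^ k *
      ((-1) ^ k * (x : ℂ) ^ (2 * k + (1 - ν)) / (Nat.factorial (2 * k + (1 - ν)) : ℂ)) := by
  unfold Slam
  split_ifs with h
  · subst h
    exact tsum_congr fun k => by ring
  · rw [Nat.sub_eq_zero_of_le (Nat.one_le_iff_ne_zero.2 h)]
    exact tsum_congr fun k => by rw [add_zero]; ring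

theorem Slam_one_sq (x : ℝ) (ρ : ℂ) : Slam 1 x (ρ ^ 2) = Complex.cos (ρ * x) := by
  rw [Complex.cos_eq_tsum, Slam, if_neg one_ne_zero]
  exact tsum_congr fun k => by rw [mul_pow, pow_mul ρ]; ring

theorem mul_Slam_zero_sq (x : ℝ) (ρ : ℂ) : ρ * Slam 0 x (ρ ^ 2) = Complex.sin (ρ * x) := by
  rw [Complex.sin_eq_tsum, Slam, if_pos rfl, ← tsum_mul_left]
  exact tsum_congr fun k => by rw [mul_pow, pow_add ρ, pow_mul ρ]; ring

theorem Slam_zero_zero (x : ℝ) : Slam 0 x 0 = x := by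
  rw [Slam, if_pos rfl, tsum_eq_single 0]
  · simp
  · intro k hk
    simp [hk]

theorem hasDerivAt_Slam_zero (lam : ℂ) (x : ℝ) :
    HasDerivAt (fun y : ℝ => Slam 0 y lam) (Slam 1 x lam) x := by
  obtain ⟨ρ, rfl⟩ := IsAlgClosed.exists_pow_nat_eq lam (n := 2) two_pos
  rw [Slam_one_sq]
  by_cases hρ : ρ = 0
  · subst hρ
    simp only [ne_eq, OfNat.ofNat_ne_zero, not_false_eq_true, zero_pow, Slam_zero_zero, zero_mul,
      Complex.cos_zero]
    exact Complex.ofRealCLM.hasDerivAt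
  · have h : (fun y : ℝ => Slam 0 y (ρ ^ 2)) = fun y : ℝ => Complex.sin (ρ * y) / ρ := by
      ext y
      rw [← mul_Slam_zero_sq, mul_div_cancel_left₀ _ hρ]
    rw [h]
    have h1 : HasDerivAt (fun y : ℝ => ρ * (y : ℂ)) (ρ * 1) x :=
      Complex.ofRealCLM.hasDerivAt.const_mul ρ
    refine (((Complex.hasDerivAt_sin (ρ * x)).comp x h1).div_const ρ).congr_deriv ?_
    field_simp

theorem hasDerivAt_Slam_one (lam : ℂ) (x : ℝ) :
    HasDerivAt (fun y : ℝ => Slam 1 y lam) (-lam * Slam 0 x lam) x := by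
  obtain ⟨ρ, rfl⟩ := IsAlgClosed.exists_pow_nat_eq lam (n := 2) two_pos
  simp only [Slam_one_sq]
  have h1 : HasDerivAt (fun y : ℝ => ρ * (y : ℂ)) (ρ * 1) x :=
    Complex.ofRealCLM.hasDerivAt.const_mul ρ
  refine ((Complex.hasDerivAt_cos (ρ * x)).comp x h1).congr_deriv ?_
  rw [← mul_Slam_zero_sq]
  ring

theorem Slam_zero_left (lam : ℂ) : Slam 0 0 lam = 0 := by
  simp [Slam]

theorem Slam_one_left (lam : ℂ) : Slam 1 0 lam = 1 := by
  obtain ⟨ρ, rfl⟩ := IsAlgClosed.exists_pow_nat_eq lam (n := 2) two_pos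
  simp [Slam_one_sq]

theorem continuous_Slam {ν : ℕ} (hν : ν = 0 ∨ ν = 1) (lam : ℂ) :
    Continuous fun x : ℝ => Slam ν x lam := by
  rcases hν with rfl | rfl
  · exact continuous_iff_continuousAt.2 fun x => (hasDerivAt_Slam_zero lam x).continuousAt
  · exact continuous_iff_continuousAt.2 fun x => (hasDerivAt_Slam_one lam x).continuousAt

theorem integral_Slam_mul_Slam {ν : ℕ} (hν : ν = 0 ∨ ν = 1) (lam z : ℂ) (x : ℝ) :
    (z - lam) * ∫ t in (0 : ℝ)..x, Slam 0 (x - t) z * Slam ν t lam =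
      Slam ν x lam - Slam ν x z := by
  have h0 : ∀ t, HasDerivAt (fun t : ℝ => Slam 0 (x - t) z) (-Slam 1 (x - t) z) t := fun t => by
    exact ((hasDerivAt_Slam_zero z (x - t)).scomp t
      ((hasDerivAt_id t).const_sub x)).congr_deriv (by simp)
  have h1 : ∀ t, HasDerivAt (fun t : ℝ => Slam 1 (x - t) z) (z * Slam 0 (x - t) z) t := fun t => by
    exact ((hasDerivAt_Slam_one z (x - t)).scomp t
      ((hasDerivAt_id t).const_sub x)).congr_deriv (by simp)
  have hcont : Continuous fun t : ℝ => Slam 0 (x - t) z * Slam ν t lam :=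
    ((continuous_Slam (Or.inl rfl) z).comp (continuous_sub_left x)).mul (continuous_Slam hν lam)
  rw [← intervalIntegral.integral_const_mul]
  rcases hν with rfl | rfl
  · rw [intervalIntegral.integral_eq_sub_of_hasDerivAt (f := fun t : ℝ =>
      Slam 0 (x - t) z * Slam 1 t lam + Slam 1 (x - t) z * Slam 0 t lam)]
    · simp [Slam_zero_left, Slam_one_left]
    · intro t _
      refine (((h0 t).mul (hasDerivAt_Slam_one lam t)).add
        ((h1 t).mul (hasDerivAt_Slam_zero lam t))).congr_deriv ?_
      ring
    · exact (hcont.const_mul _).intervalIntegrable _ _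
  · rw [intervalIntegral.integral_eq_sub_of_hasDerivAt (f := fun t : ℝ =>
      Slam 0 (x - t) z * (-lam * Slam 0 t lam) + Slam 1 (x - t) z * Slam 1 t lam)]
    · simp [Slam_zero_left, Slam_one_left]
    · intro t _
      refine (((h0 t).mul ((hasDerivAt_Slam_zero lam t).const_mul (-lam))).add
        ((h1 t).mul (hasDerivAt_Slam_one lam t))).congr_deriv ?_
      ring
    · exact (hcont.const_mul _).intervalIntegrable _ _

end Slam

section L2

open scoped BoundedContinuousFunction InnerProductSpace

theorem ContinuousLinearMap.iteratedDeriv_comp_left {𝕜 E F : Type*} [NontriviallyNormedField 𝕜]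
    [NormedAddCommGroup E] [NormedSpace 𝕜 E] [NormedAddCommGroup F] [NormedSpace 𝕜 F]
    (L : E →L[𝕜] F) {f : 𝕜 → E} {m : ℕ} {x : 𝕜} (hf : ContDiffAt 𝕜 m f x) :
    iteratedDeriv m (fun y => L (f y)) x = L (iteratedDeriv m f x) := by
  rw [iteratedDeriv_eq_iteratedFDeriv, iteratedDeriv_eq_iteratedFDeriv]
  change iteratedFDeriv 𝕜 m (L ∘ f) x _ = _
  rw [L.iteratedFDeriv_comp_left hf le_rfl]
  rfl

/-- The Lebesgue measure on `(0,1)`. -/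
noncomputable abbrev volumeIoo : Measure ℝ := volume.restrict (Ioo (0 : ℝ) 1)

instance : IsProbabilityMeasure volumeIoo := ⟨by simp [volumeIoo]⟩

/-- The coefficient of `λ^k` in `S_ν(x,λ)`, with `x` clamped to `[0,1]`. -/
noncomputable def slamCoeff (ν k : ℕ) : ℝ →ᵇ ℂ :=
  BoundedContinuousFunction.ofNormedAddCommGroup
    (fun x => (-1) ^ k * ((projIcc (0 : ℝ) 1 zero_le_one x : ℝ) : ℂ) ^ (2 * k + (1 - ν)) /
      (Nat.factorial (2 * k + (1 - ν)) : ℂ))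
    (by fun_prop) (1 / (Nat.factorial k : ℝ)) fun x => by
      have hx := (projIcc (0 : ℝ) 1 zero_le_one x).2
      rw [norm_div, norm_mul, norm_pow, norm_neg, norm_one, one_pow, one_mul, norm_pow,
        Complex.norm_natCast, Complex.norm_real, Real.norm_of_nonneg hx.1]
      gcongr
      · exact pow_le_one₀ hx.1 hx.2
      · omega

theorem norm_slamCoeff_le (ν k : ℕ) : ‖slamCoeff ν k‖ ≤ 1 / (Nat.factorial k : ℝ) :=
  BoundedContinuousFunction.norm_ofNormedAddCommGroup_le _ (by positivity) _

/-- `λ ↦ S_ν(·,λ)` with values in the bounded continuous functions. -/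
noncomputable def slamBCF (ν : ℕ) (lam : ℂ) : ℝ →ᵇ ℂ :=
  ∑' k : ℕ, lam ^ k • slamCoeff ν k

theorem norm_pow_smul_slamCoeff_le (ν k : ℕ) {lam : ℂ} {R : ℝ} (h : ‖lam‖ ≤ R) :
    ‖lam ^ k • slamCoeff ν k‖ ≤ R ^ k / (Nat.factorial k : ℝ) := by
  have hR : 0 ≤ R := (norm_nonneg _).trans h
  rw [norm_smul, norm_pow, div_eq_mul_one_div (R ^ k)]
  gcongr
  exact norm_slamCoeff_le ν k

theorem summable_slamCoeff (ν : ℕ) (lam : ℂ) : Summable fun k : ℕ => lam ^ k • slamCoeff ν k :=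
  Summable.of_norm_bounded (Real.summable_pow_div_factorial ‖lam‖)
    fun k => norm_pow_smul_slamCoeff_le ν k le_rfl

theorem slamBCF_apply (ν : ℕ) (lam : ℂ) (x : ℝ) :
    slamBCF ν lam x = Slam ν (projIcc (0 : ℝ) 1 zero_le_one x) lam := by
  rw [Slam_eq_tsum, slamBCF]
  change BoundedContinuousFunction.evalCLM ℂ x _ = _
  rw [ContinuousLinearMap.map_tsum _ (summable_slamCoeff ν lam)]
  rfl

theorem slamBCF_apply_of_mem (ν : ℕ) (lam : ℂ) {x : ℝ} (hx : x ∈ Icc (0 : ℝ) 1) :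
    slamBCF ν lam x = Slam ν x lam := by
  rw [slamBCF_apply, projIcc_of_mem _ hx]

theorem differentiable_slamBCF (ν : ℕ) : Differentiable ℂ (slamBCF ν) := fun z => by
  have h : DifferentiableOn ℂ (slamBCF ν) (Metric.ball 0 (‖z‖ + 1)) :=
    Complex.differentiableOn_tsum_of_summable_norm
      (Real.summable_pow_div_factorial (‖z‖ + 1))
      (fun k => by fun_prop) Metric.isOpen_ball
      fun k w hw => norm_pow_smul_slamCoeff_le ν k (mem_ball_zero_iff.1 hw).le
  exact h.differentiableAt (Metric.isOpen_ball.mem_nhds (by simp))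

/-- `λ ↦ S_ν(·,λ)` with values in `L²(0,1)`. -/
noncomputable def slamLp (ν : ℕ) (lam : ℂ) : Lp ℂ 2 volumeIoo :=
  BoundedContinuousFunction.toLp 2 volumeIoo ℂ (slamBCF ν lam)

theorem differentiable_slamLp (ν : ℕ) : Differentiable ℂ (slamLp ν) :=
  (BoundedContinuousFunction.toLp 2 volumeIoo ℂ).differentiable.comp (differentiable_slamBCF ν)

theorem coeFn_slamLp (ν : ℕ) (lam : ℂ) :
    slamLp ν lam =ᵐ[volumeIoo] fun x => Slam ν x lam := by
  filter_upwards [BoundedContinuousFunction.coeFn_toLp 2 volumeIoo ℂ (slamBCF ν lam),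
    ae_restrict_mem measurableSet_Ioo] with x hx hmem
  exact hx.trans (slamBCF_apply_of_mem ν lam (Ioo_subset_Icc_self hmem))

theorem coeFn_iteratedDeriv_slamLp (ν m : ℕ) (lam : ℂ) :
    ((iteratedDeriv m (slamLp ν) lam : Lp ℂ 2 volumeIoo) : ℝ → ℂ) =ᵐ[volumeIoo]
      fun x => iteratedDeriv m (fun z => Slam ν x z) lam := by
  have hd : ContDiffAt ℂ m (slamBCF ν) lam := (differentiable_slamBCF ν).contDiff.contDiffAt
  have h : iteratedDeriv m (slamLp ν) lam =
      BoundedContinuousFunction.toLp 2 volumeIoo ℂ (iteratedDeriv m (slamBCF ν) lam) :=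
    (BoundedContinuousFunction.toLp 2 volumeIoo ℂ).iteratedDeriv_comp_left hd
  rw [h]
  filter_upwards [BoundedContinuousFunction.coeFn_toLp 2 volumeIoo ℂ
    (iteratedDeriv m (slamBCF ν) lam), ae_restrict_mem measurableSet_Ioo] with x hx hmem
  rw [hx]
  refine ((BoundedContinuousFunction.evalCLM ℂ x).iteratedDeriv_comp_left hd).symm.trans ?_
  congr 1
  ext z
  exact slamBCF_apply_of_mem ν z (Ioo_subset_Icc_self hmem)

theorem integral_norm_le_norm (h : Lp ℂ 2 volumeIoo) : ∫ t, ‖h t‖ ∂volumeIoo ≤ ‖h‖ := by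
  rw [integral_norm_eq_lintegral_enorm (Lp.aestronglyMeasurable h),
    ← eLpNorm_one_eq_lintegral_enorm, Lp.norm_def]
  exact ENNReal.toReal_mono (Lp.eLpNorm_ne_top h)
    (eLpNorm_le_eLpNorm_of_exponent_le (by norm_num) (Lp.aestronglyMeasurable h))

theorem integrable_coeFn (h : Lp ℂ 2 volumeIoo) : Integrable h volumeIoo :=
  (Lp.memLp h).integrable (by norm_num)

/-- Convolution with a continuous kernel on `0 < t < x < 1` is bounded on `L²(0,1)`. -/
theorem exists_volterra_operator {k : ℝ → ℂ} (hk : Continuous k) :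
    ∃ V : Lp ℂ 2 volumeIoo →L[ℂ] Lp ℂ 2 volumeIoo, ∀ h, V h =ᵐ[volumeIoo]
      fun x => ∫ t in (0 : ℝ)..x, k (x - t) * h t := by
  obtain ⟨C, hC⟩ := isCompact_Icc.exists_bound_of_continuousOn (s := Icc (-1 : ℝ) 1)
    hk.continuousOn
  have hC0 : 0 ≤ C := (norm_nonneg _).trans (hC 0 (by simp))
  let I : Lp ℂ 2 volumeIoo → ℝ → ℂ := fun h x =>
    ∫ t, (Iio x).indicator (fun t => k (x - t) * h t) t ∂volumeIoo
  have hle : ∀ h : Lp ℂ 2 volumeIoo, ∀ x ∈ Ioo (0 : ℝ) 1, ∀ᵐ t ∂volumeIoo,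
      ‖(Iio x).indicator (fun t => k (x - t) * h t) t‖ ≤ C * ‖h t‖ := fun h x hx => by
    filter_upwards [ae_restrict_mem measurableSet_Ioo] with t ht
    refine (norm_indicator_le_norm_self _ _).trans ?_
    rw [norm_mul]
    gcongr
    exact hC _ ⟨by linarith [hx.1, ht.2], by linarith [hx.2, ht.1]⟩
  have hmeas : ∀ h : Lp ℂ 2 volumeIoo, ∀ x, AEStronglyMeasurable
      ((Iio x).indicator (fun t => k (x - t) * h t)) volumeIoo := fun h x =>
    ((hk.comp (continuous_sub_left x)).aestronglyMeasurable.mul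
      (Lp.aestronglyMeasurable h)).indicator measurableSet_Iio
  have h_integrable : ∀ h : Lp ℂ 2 volumeIoo, ∀ x ∈ Ioo (0 : ℝ) 1, Integrable
      ((Iio x).indicator (fun t => k (x - t) * h t)) volumeIoo := fun h x hx =>
    ((integrable_coeFn h).norm.const_mul C).mono' (hmeas h x) (hle h x hx)
  have hbound : ∀ h, ∀ x ∈ Ioo (0 : ℝ) 1, ‖I h x‖ ≤ C * ‖h‖ := fun h x hx =>
    (norm_integral_le_of_norm_le ((integrable_coeFn h).norm.const_mul C) (hle h x hx)).trans <| by
      rw [integral_const_mul]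
      gcongr
      exact integral_norm_le_norm h
  have hI : ∀ h, AEStronglyMeasurable (I h) volumeIoo := fun h => by
    refine StronglyMeasurable.aestronglyMeasurable ?_
    refine StronglyMeasurable.integral_prod_right
      (f := fun x t => (Iio x).indicator (fun t => k (x - t) * h t) t) ?_
    have h1 : StronglyMeasurable fun p : ℝ × ℝ => k (p.1 - p.2) * h p.2 :=
      (hk.comp (continuous_fst.sub continuous_snd)).stronglyMeasurable.mul
        ((Lp.stronglyMeasurable h).comp_measurable measurable_snd)
    exact h1.indicator (measurableSet_lt measurable_snd measurable_fst)
  have hmem : ∀ h, MemLp (I h) 2 volumeIoo := fun h =>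
    MemLp.of_bound (hI h) (C * ‖h‖) <| by
      filter_upwards [ae_restrict_mem measurableSet_Ioo] with x hx using hbound h x hx
  let L : Lp ℂ 2 volumeIoo →ₗ[ℂ] Lp ℂ 2 volumeIoo :=
    { toFun := fun h => (hmem h).toLp
      map_add' := fun f g => by
        rw [← MemLp.toLp_add]
        refine MemLp.toLp_congr _ _ ?_
        filter_upwards [ae_restrict_mem measurableSet_Ioo] with x hx
        rw [Pi.add_apply, ← integral_add (h_integrable f x hx) (h_integrable g x hx)]
        refine integral_congr_ae ?_
        filter_upwards [Lp.coeFn_add f g] with t ht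
        by_cases htx : t ∈ Iio x
        · simp only [indicator_of_mem htx, ht, Pi.add_apply, mul_add]
        · simp only [indicator_of_notMem htx, add_zero]
      map_smul' := fun a f => by
        rw [RingHom.id_apply, ← MemLp.toLp_const_smul]
        refine MemLp.toLp_congr _ _ ?_
        filter_upwards [ae_restrict_mem measurableSet_Ioo] with x hx
        rw [Pi.smul_apply, ← integral_smul]
        refine integral_congr_ae ?_
        filter_upwards [Lp.coeFn_smul a f] with t ht
        by_cases htx : t ∈ Iio x
        · simp only [indicator_of_mem htx, ht, Pi.smul_apply, smul_eq_mul]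
          ring
        · simp only [indicator_of_notMem htx, smul_zero] }
  refine ⟨L.mkContinuous C fun h => ?_, fun h => ?_⟩
  · have := Lp.norm_le_of_ae_bound (f := L h) (C := C * ‖h‖) (by positivity) <| by
      filter_upwards [(hmem h).coeFn_toLp, ae_restrict_mem measurableSet_Ioo] with x hx hx'
      exact (congrArg norm hx).trans_le (hbound h x hx')
    have hu : measureUnivNNReal volumeIoo = 1 := by simp [measureUnivNNReal]
    simpa [hu] using this
  · filter_upwards [(hmem h).coeFn_toLp, ae_restrict_mem measurableSet_Ioo] with x hx hx'
    refine hx.trans ?_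
    rw [intervalIntegral.integral_of_le hx'.1.le, integral_Ioc_eq_integral_Ioo]
    change ∫ t, _ ∂volumeIoo = _
    rw [integral_indicator measurableSet_Iio, Measure.restrict_restrict measurableSet_Iio]
    congr 2
    ext t
    simp only [mem_inter_iff, mem_Iio, mem_Ioo]
    constructor
    · rintro ⟨h1, h2, -⟩
      exact ⟨h2, h1⟩
    · rintro ⟨h1, h2⟩
      exact ⟨h2, h1, h2.trans hx'.2⟩

/-- The transform `λ ↦ ⟪f, S_ν(·,λ)⟫` may be divided by `λ - z` whenever it vanishes at `z`. -/
theorem exists_inner_slamLp_divided_difference {ν : ℕ} (hν : ν = 0 ∨ ν = 1)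
    (f : Lp ℂ 2 volumeIoo) (z : ℂ) :
    ∃ g : Lp ℂ 2 volumeIoo, ∀ lam,
      (lam - z) * ⟪g, slamLp ν lam⟫_ℂ = ⟪f, slamLp ν lam⟫_ℂ - ⟪f, slamLp ν z⟫_ℂ := by
  obtain ⟨V, hV⟩ := exists_volterra_operator (continuous_Slam (Or.inl rfl) z)
  refine ⟨-(ContinuousLinearMap.adjoint V f), fun lam => ?_⟩
  have h : (z - lam) • V (slamLp ν lam) = slamLp ν lam - slamLp ν z := by
    refine Lp.ext ?_
    filter_upwards [Lp.coeFn_smul (z - lam) (V (slamLp ν lam)),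
      Lp.coeFn_sub (slamLp ν lam) (slamLp ν z), hV (slamLp ν lam), coeFn_slamLp ν lam,
      coeFn_slamLp ν z, ae_restrict_mem measurableSet_Ioo] with x h1 h2 h3 h4 h5 hx
    rw [h1, h2, Pi.smul_apply, Pi.sub_apply, h3, h4, h5, ← integral_Slam_mul_Slam hν, smul_eq_mul]
    congr 1
    refine intervalIntegral.integral_congr_ae_restrict ?_
    rw [uIoc_of_le hx.1.le]
    have hae : slamLp ν lam =ᵐ[volume.restrict (Ioc 0 x)] fun x => Slam ν x lam :=
      ae_restrict_of_ae_restrict_of_subset (Ioc_subset_Ioo_right hx.2) (coeFn_slamLp ν lam)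
    filter_upwards [hae] with t ht
    rw [ht]
  rw [inner_neg_left, ContinuousLinearMap.adjoint_inner_left, ← inner_sub_right, ← h,
    inner_smul_right]
  ring

end L2

section HalfInteger

open scoped InnerProductSpace

/-- `sin (π(j-1/2)x)` for `ν = 0` and `cos (π(j-1/2)x)` otherwise. -/
noncomputable def halfTrig (ν : ℕ) (j : ℤ) (x : ℝ) : ℝ :=
  if ν = 0 then sin (π * (j - 1 / 2) * x) else cos (π * (j - 1 / 2) * x)

theorem continuous_halfTrig (ν : ℕ) (j : ℤ) : Continuous (halfTrig ν j) := by
  unfold halfTrig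
  split_ifs <;> fun_prop

theorem two_mul_cos_mul_halfTrig (ν : ℕ) (j : ℤ) (x : ℝ) :
    2 * cos (π * x) * halfTrig ν j x = halfTrig ν (j + 1) x + halfTrig ν (j - 1) x := by
  have h1 : π * (((j + 1 : ℤ) : ℝ) - 1 / 2) * x = π * (j - 1 / 2) * x + π * x := by
    push_cast; ring
  have h2 : π * (((j - 1 : ℤ) : ℝ) - 1 / 2) * x = π * (j - 1 / 2) * x - π * x := by
    push_cast; ring
  unfold halfTrig
  rw [h1, h2]
  split_ifs
  · rw [sin_add, sin_sub]; ring
  · rw [cos_add, cos_sub]; ring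

theorem exists_halfTrig_one_sub_eq (ν : ℕ) (j : ℤ) :
    ∃ a : ℝ, ∀ x, halfTrig ν (1 - j) x = a * halfTrig ν j x := by
  have h1 : ∀ x, π * (((1 - j : ℤ) : ℝ) - 1 / 2) * x = -(π * (j - 1 / 2) * x) := fun x => by
    push_cast; ring
  unfold halfTrig
  simp only [h1]
  split_ifs
  · exact ⟨-1, fun x => by rw [sin_neg]; ring⟩
  · exact ⟨1, fun x => by rw [cos_neg]; ring⟩

theorem integral_cos_int_mul_pi (k : ℤ) :
    ∫ x in (0 : ℝ)..1, cos (π * k * x) = if k = 0 then 1 else 0 := by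
  split_ifs with h
  · simp [h]
  · have hk : π * (k : ℝ) ≠ 0 := mul_ne_zero pi_ne_zero (by exact_mod_cast h)
    rw [intervalIntegral.integral_comp_mul_left _ hk, integral_cos, mul_zero, sin_zero, mul_one,
      mul_comm π, sin_int_mul_pi]
    simp

theorem integral_halfTrig_mul_halfTrig (ν : ℕ) {i j : ℤ} (hi : 1 ≤ i) (hj : 1 ≤ j) :
    ∫ x in (0 : ℝ)..1, 2 * (halfTrig ν i x * halfTrig ν j x) = if i = j then 1 else 0 := by
  have hd : ∀ x, π * (i - 1 / 2) * x - π * (j - 1 / 2) * x = π * ((i - j : ℤ) : ℝ) * x :=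
    fun x => by push_cast; ring
  have hs : ∀ x, π * (i - 1 / 2) * x + π * (j - 1 / 2) * x = π * ((i + j - 1 : ℤ) : ℝ) * x :=
    fun x => by push_cast; ring
  have h_integrable : ∀ k : ℤ, IntervalIntegrable (fun x => cos (π * k * x)) volume 0 1 := fun k =>
    Continuous.intervalIntegrable (by fun_prop) _ _
  have hij : i + j - 1 ≠ 0 := by omega
  unfold halfTrig
  split_ifs with hν h h
  all_goals
    simp only [← mul_assoc, two_mul_sin_mul_sin, two_mul_cos_mul_cos, hd, hs]
    first
      | rw [intervalIntegral.integral_sub (h_integrable _) (h_integrable _)]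
      | rw [intervalIntegral.integral_add (h_integrable _) (h_integrable _)]
    rw [integral_cos_int_mul_pi, integral_cos_int_mul_pi, if_neg hij]
    simp [sub_eq_zero, h]

theorem integrable_continuous_mul_coeFn {w : ℝ → ℝ} (hw : Continuous w) (f : Lp ℂ 2 volumeIoo) :
    Integrable (fun x => (w x : ℂ) * f x) volumeIoo := by
  obtain ⟨C, hC⟩ := isCompact_Icc.exists_bound_of_continuousOn (s := Icc (0 : ℝ) 1)
    hw.continuousOn
  refine (integrable_coeFn f).bdd_mul (c := C)
    (Complex.continuous_ofReal.comp hw).aestronglyMeasurable ?_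
  filter_upwards [ae_restrict_mem measurableSet_Ioo] with x hx
  simpa using hC x (Ioo_subset_Icc_self hx)

theorem integral_halfTrig_mul_eq_zero {ν : ℕ} {f : Lp ℂ 2 volumeIoo}
    (h : ∀ n : ℤ, 1 ≤ n → ∫ x, (halfTrig ν n x : ℂ) * f x ∂volumeIoo = 0) (j : ℤ) :
    ∫ x, (halfTrig ν j x : ℂ) * f x ∂volumeIoo = 0 := by
  rcases le_or_gt 1 j with hj | hj
  · exact h j hj
  · obtain ⟨a, ha⟩ := exists_halfTrig_one_sub_eq ν (1 - j)
    simp only [sub_sub_cancel] at ha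
    simp only [ha, Complex.ofReal_mul, mul_assoc]
    rw [integral_const_mul, h _ (by omega), mul_zero]

theorem integral_cos_pow_mul_halfTrig_mul_eq_zero {ν : ℕ} {f : Lp ℂ 2 volumeIoo}
    (h : ∀ n : ℤ, 1 ≤ n → ∫ x, (halfTrig ν n x : ℂ) * f x ∂volumeIoo = 0) (k : ℕ) (j : ℤ) :
    ∫ x, ((cos (π * x) ^ k * halfTrig ν j x : ℝ) : ℂ) * f x ∂volumeIoo = 0 := by
  induction k generalizing j with
  | zero => simpa using integral_halfTrig_mul_eq_zero h j
  | succ k ih =>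
    have hx : ∀ x, ((cos (π * x) ^ (k + 1) * halfTrig ν j x : ℝ) : ℂ) * f x =
        (1 / 2 : ℂ) * (((cos (π * x) ^ k * halfTrig ν (j + 1) x : ℝ) : ℂ) * f x +
          ((cos (π * x) ^ k * halfTrig ν (j - 1) x : ℝ) : ℂ) * f x) := fun x => by
      rw [← add_mul, ← Complex.ofReal_add, ← mul_add, ← two_mul_cos_mul_halfTrig]
      push_cast
      ring
    have hi : ∀ j, Integrable (fun x => ((cos (π * x) ^ k * halfTrig ν j x : ℝ) : ℂ) * f x)
        volumeIoo := fun j =>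
      integrable_continuous_mul_coeFn
        (Continuous.mul (by fun_prop) (continuous_halfTrig ν j)) f
    simp only [hx]
    rw [integral_const_mul, integral_add (hi _) (hi _), ih, ih]
    simp

theorem integral_polynomial_cos_mul_eq_zero {ν : ℕ} {f : Lp ℂ 2 volumeIoo}
    (h : ∀ n : ℤ, 1 ≤ n → ∫ x, (halfTrig ν n x : ℂ) * f x ∂volumeIoo = 0) (p : Polynomial ℝ) :
    ∫ x, ((p.eval (cos (π * x)) * halfTrig ν 1 x : ℝ) : ℂ) * f x ∂volumeIoo = 0 := by
  have hi : ∀ p : Polynomial ℝ, Integrable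
      (fun x => ((p.eval (cos (π * x)) * halfTrig ν 1 x : ℝ) : ℂ) * f x) volumeIoo := fun p =>
    integrable_continuous_mul_coeFn
      ((p.continuous.comp (by fun_prop)).mul (continuous_halfTrig ν 1)) f
  induction p using Polynomial.induction_on' with
  | add p q hp hq =>
    simp only [Polynomial.eval_add, add_mul, Complex.ofReal_add]
    rw [integral_add (hi p) (hi q), hp, hq, add_zero]
  | monomial k a =>
    simp only [Polynomial.eval_monomial, mul_assoc a, Complex.ofReal_mul a, mul_assoc (a : ℂ)]
    rw [integral_const_mul, integral_cos_pow_mul_halfTrig_mul_eq_zero h, mul_zero]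

theorem halfTrig_one_ne_zero (ν : ℕ) {x : ℝ} (hx : x ∈ Ioo (0 : ℝ) 1) : halfTrig ν 1 x ≠ 0 := by
  have h1 := mul_pos pi_pos hx.1
  have h2 := mul_lt_of_lt_one_right pi_pos hx.2
  have h3 : π * (((1 : ℤ) : ℝ) - 1 / 2) * x = π * x / 2 := by push_cast; ring
  unfold halfTrig
  rw [h3]
  split_ifs
  · exact (sin_pos_of_pos_of_lt_pi (by linarith) (by linarith)).ne'
  · exact (cos_pos_of_mem_Ioo ⟨by linarith, by linarith⟩).ne'

theorem eq_zero_of_integral_halfTrig_mul_eq_zero {ν : ℕ} {f : Lp ℂ 2 volumeIoo}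
    (h : ∀ n : ℤ, 1 ≤ n → ∫ x, (halfTrig ν n x : ℂ) * f x ∂volumeIoo = 0) : f = 0 := by
  have hg := integrable_continuous_mul_coeFn (continuous_halfTrig ν 1) f
  have key : ∀ φ : ℝ → ℝ, Continuous φ →
      ∫ x, φ x • ((halfTrig ν 1 x : ℂ) * f x) ∂volumeIoo = 0 := fun φ hφ => by
    set B := ∫ x, ‖(halfTrig ν 1 x : ℂ) * f x‖ ∂volumeIoo with hB
    have hB0 : 0 ≤ B := integral_nonneg fun x => norm_nonneg _
    have hle : ∀ ε > 0, ‖∫ x, φ x • ((halfTrig ν 1 x : ℂ) * f x) ∂volumeIoo‖ ≤ ε * B :=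
        fun ε hε => by
      obtain ⟨p, hp⟩ := exists_polynomial_near_of_continuousOn (-1) 1
        (fun t => φ (arccos t / π)) (by fun_prop) ε hε
      have hi : Integrable (fun x => ((p.eval (cos (π * x)) * halfTrig ν 1 x : ℝ) : ℂ) * f x)
          volumeIoo := integrable_continuous_mul_coeFn
        ((p.continuous.comp (by fun_prop)).mul (continuous_halfTrig ν 1)) f
      have hi' : Integrable (fun x => φ x • ((halfTrig ν 1 x : ℂ) * f x)) volumeIoo := by
        have := integrable_continuous_mul_coeFn (hφ.mul (continuous_halfTrig ν 1)) f
        simpa only [Pi.mul_apply, Complex.ofReal_mul, mul_assoc, Complex.real_smul] using this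
      rw [← sub_zero (∫ x, φ x • ((halfTrig ν 1 x : ℂ) * f x) ∂volumeIoo),
        ← integral_polynomial_cos_mul_eq_zero h p, ← integral_sub hi' hi, hB, ← integral_const_mul]
      refine norm_integral_le_of_norm_le (hg.norm.const_mul ε) ?_
      filter_upwards [ae_restrict_mem measurableSet_Ioo] with x hx
      have hφx := hp (cos (π * x)) ⟨neg_one_le_cos _, cos_le_one _⟩
      rw [arccos_cos (mul_nonneg pi_pos.le hx.1.le) (mul_le_of_le_one_right pi_pos.le hx.2.le),
        mul_div_cancel_left₀ _ pi_ne_zero, abs_sub_comm] at hφx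
      rw [Complex.real_smul, Complex.ofReal_mul, mul_assoc, ← sub_mul, norm_mul,
        ← Complex.ofReal_sub, Complex.norm_real]
      gcongr
      exact hφx.le
    refine norm_le_zero_iff.1 (le_of_forall_pos_le_add fun δ hδ => ?_)
    refine (hle (δ / (B + 1)) (by positivity)).trans ?_
    rw [zero_add, div_mul_eq_mul_div, div_le_iff₀ (by positivity)]
    nlinarith
  have hae := isOpen_Ioo.ae_eq_zero_of_integral_contDiff_smul_eq_zero (U := Ioo (0 : ℝ) 1)
    (hg.locallyIntegrable.locallyIntegrableOn _) fun φ hφ _ _ => key φ hφ.continuous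
  refine Lp.ext ?_
  filter_upwards [hae, ae_restrict_mem measurableSet_Ioo, Lp.coeFn_zero ℂ 2 volumeIoo]
    with x h1 hx h0
  rw [h0]
  refine (mul_eq_zero.1 (h1 hx)).resolve_left ?_
  exact_mod_cast halfTrig_one_ne_zero ν hx

/-- `√2 sin (π(n-1/2)x)` or `√2 cos (π(n-1/2)x)`, as a multiple of `S_ν(·,π²(n-1/2)²)`. -/
noncomputable def halfTrigLp (ν n : ℕ) : Lp ℂ 2 volumeIoo :=
  ((√2 : ℂ) * ((π : ℂ) * (n - 1 / 2)) ^ (1 - ν)) • slamLp ν ((π : ℂ) ^ 2 * (n - 1 / 2) ^ 2)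

theorem coeFn_halfTrigLp {ν : ℕ} (hν : ν = 0 ∨ ν = 1) (n : ℕ) :
    halfTrigLp ν n =ᵐ[volumeIoo] fun x => ((√2 * halfTrig ν n x : ℝ) : ℂ) := by
  filter_upwards [Lp.coeFn_smul ((√2 : ℂ) * ((π : ℂ) * (n - 1 / 2)) ^ (1 - ν))
    (slamLp ν ((π : ℂ) ^ 2 * (n - 1 / 2) ^ 2)), coeFn_slamLp ν ((π : ℂ) ^ 2 * (n - 1 / 2) ^ 2)]
    with x h1 h2
  rw [halfTrigLp, h1, Pi.smul_apply, h2, smul_eq_mul, mul_assoc, Complex.ofReal_mul, ← mul_pow]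
  congr 1
  rcases hν with rfl | rfl
  · rw [Nat.sub_zero, pow_one, mul_Slam_zero_sq]
    simp [halfTrig]
  · rw [Nat.sub_self, pow_zero, one_mul, Slam_one_sq]
    simp [halfTrig]

theorem orthonormal_halfTrigLp {ν : ℕ} (hν : ν = 0 ∨ ν = 1) :
    Orthonormal ℂ fun n : {n : ℕ // 1 ≤ n} => halfTrigLp ν n := by
  rw [orthonormal_iff_ite]
  intro m n
  have h : ⟪halfTrigLp ν m, halfTrigLp ν n⟫_ℂ =
      ∫ x in Ioo (0 : ℝ) 1, ((2 * (halfTrig ν m x * halfTrig ν n x) : ℝ) : ℂ) := by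
    rw [L2.inner_def]
    refine integral_congr_ae ?_
    filter_upwards [coeFn_halfTrigLp hν m, coeFn_halfTrigLp hν n] with x h1 h2
    rw [h1, h2, RCLike.inner_apply, Complex.conj_ofReal, ← Complex.ofReal_mul]
    congr 1
    linear_combination (halfTrig ν m x * halfTrig ν n x) * Real.mul_self_sqrt zero_le_two
  rw [h, integral_complex_ofReal, ← integral_Ioc_eq_integral_Ioo,
    ← intervalIntegral.integral_of_le zero_le_one,
    integral_halfTrig_mul_halfTrig ν (by exact_mod_cast m.2) (by exact_mod_cast n.2)]
  simp only [Nat.cast_inj, Subtype.ext_iff]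
  split_ifs <;> simp

theorem eq_zero_of_inner_halfTrigLp_eq_zero {ν : ℕ} (hν : ν = 0 ∨ ν = 1) {f : Lp ℂ 2 volumeIoo}
    (h : ∀ n : ℕ, 1 ≤ n → ⟪halfTrigLp ν n, f⟫_ℂ = 0) : f = 0 := by
  refine eq_zero_of_integral_halfTrig_mul_eq_zero (ν := ν) fun j hj => ?_
  lift j to ℕ using by omega
  have hn := h j (by exact_mod_cast hj)
  have h2 : (√2 : ℂ) ≠ 0 := by simp
  rw [← mul_right_inj' h2, mul_zero, ← hn, L2.inner_def, ← integral_const_mul]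
  refine integral_congr_ae ?_
  filter_upwards [coeFn_halfTrigLp hν j] with x hx
  rw [hx, RCLike.inner_apply, Complex.conj_ofReal]
  push_cast
  ring

theorem exists_hilbertBasis_halfTrigLp {ν : ℕ} (hν : ν = 0 ∨ ν = 1) :
    ∃ e : HilbertBasis {n : ℕ // 1 ≤ n} ℂ (Lp ℂ 2 volumeIoo), ∀ n, e n = halfTrigLp ν n := by
  refine ⟨HilbertBasis.mkOfOrthogonalEqBot (orthonormal_halfTrigLp hν) ?_, fun n => by
    rw [HilbertBasis.coe_mkOfOrthogonalEqBot]⟩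
  refine (Submodule.eq_bot_iff _).2 fun f hf => eq_zero_of_inner_halfTrigLp_eq_zero hν fun n hn => ?_
  exact (Submodule.mem_orthogonal _ _).1 hf _ (Submodule.subset_span ⟨⟨n, hn⟩, rfl⟩)

end HalfInteger

section Asymptotics

open scoped InnerProductSpace

theorem Complex.norm_cos_sub_one_le {b : ℂ} (hb : ‖b‖ ≤ 1) : ‖Complex.cos b - 1‖ ≤ 2 * ‖b‖ := by
  have h1 := Complex.norm_exp_sub_one_le (x := b * Complex.I) (by simpa using hb)
  have h2 := Complex.norm_exp_sub_one_le (x := -b * Complex.I) (by simpa using hb)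
  have h : Complex.cos b - 1 =
      ((Complex.exp (b * Complex.I) - 1) + (Complex.exp (-b * Complex.I) - 1)) / 2 := by
    rw [Complex.cos]; ring
  simp only [norm_mul, norm_neg, Complex.norm_I, mul_one] at h1 h2
  rw [h, norm_div, Complex.norm_ofNat, div_le_iff₀ two_pos]
  linarith [norm_add_le (Complex.exp (b * Complex.I) - 1) (Complex.exp (-b * Complex.I) - 1)]

theorem Complex.norm_sin_le_two_mul {b : ℂ} (hb : ‖b‖ ≤ 1) : ‖Complex.sin b‖ ≤ 2 * ‖b‖ := by
  have h1 := Complex.norm_exp_sub_one_le (x := b * Complex.I) (by simpa using hb)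
  have h2 := Complex.norm_exp_sub_one_le (x := -b * Complex.I) (by simpa using hb)
  have h : Complex.sin b =
      ((Complex.exp (-b * Complex.I) - 1) - (Complex.exp (b * Complex.I) - 1)) * Complex.I / 2 := by
    rw [Complex.sin]; ring
  simp only [norm_mul, norm_neg, Complex.norm_I, mul_one] at h1 h2
  rw [h, norm_div, norm_mul, Complex.norm_I, mul_one, Complex.norm_ofNat, div_le_iff₀ two_pos]
  linarith [norm_sub_le (Complex.exp (-b * Complex.I) - 1) (Complex.exp (b * Complex.I) - 1)]

theorem Complex.norm_ofReal_mul_add_ofReal_mul_le {s t : ℝ} (hs : |s| ≤ 1) (ht : |t| ≤ 1)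
    {b : ℂ} (hb : ‖b‖ ≤ 1) :
    ‖(s : ℂ) * (Complex.cos b - 1) + t * Complex.sin b‖ ≤ 4 * ‖b‖ := by
  refine (norm_add_le _ _).trans ?_
  rw [norm_mul, norm_mul, Complex.norm_real, Complex.norm_real]
  have h1 := mul_le_mul hs (Complex.norm_cos_sub_one_le hb) (norm_nonneg _) zero_le_one
  have h2 := mul_le_mul ht (Complex.norm_sin_le_two_mul hb) (norm_nonneg _) zero_le_one
  simp only [← Real.norm_eq_abs] at h1 h2
  linarith

theorem Complex.norm_cos_ofReal_add_sub_le (a : ℝ) {b : ℂ} (hb : ‖b‖ ≤ 1) :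
    ‖Complex.cos (a + b) - Complex.cos a‖ ≤ 4 * ‖b‖ := by
  convert Complex.norm_ofReal_mul_add_ofReal_mul_le (s := Real.cos a) (t := -Real.sin a)
    (abs_cos_le_one a) (by simpa using abs_sin_le_one a) hb using 2
  rw [Complex.cos_add]
  push_cast
  ring

theorem Complex.norm_sin_ofReal_add_sub_le (a : ℝ) {b : ℂ} (hb : ‖b‖ ≤ 1) :
    ‖Complex.sin (a + b) - Complex.sin a‖ ≤ 4 * ‖b‖ := by
  convert Complex.norm_ofReal_mul_add_ofReal_mul_le (s := Real.sin a) (t := Real.cos a)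
    (abs_sin_le_one a) (abs_cos_le_one a) hb using 2
  rw [Complex.sin_add]
  push_cast
  ring

theorem norm_natCast_mul_Slam_sub_le {ν n : ℕ} (hν : ν = 0 ∨ ν = 1) (hn : 1 ≤ n) {κ : ℂ}
    (hκ : ‖κ‖ ≤ 1 / 4) {x : ℝ} (hx : x ∈ Ioo (0 : ℝ) 1) :
    ‖(n : ℂ) ^ (1 - ν) * Slam ν x ((π : ℂ) ^ 2 * (n - 1 / 2 + κ) ^ 2) -
      (1 / π : ℂ) ^ (1 - ν) * halfTrig ν n x‖ ≤ 16 * ‖κ‖ + 1 / n := by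
  have hn' : (1 : ℝ) ≤ n := by exact_mod_cast hn
  have hπ : (π : ℂ) ≠ 0 := by exact_mod_cast pi_ne_zero
  have hb : ‖(π : ℂ) * κ * x‖ ≤ π * ‖κ‖ := by
    rw [norm_mul, norm_mul, Complex.norm_real, Complex.norm_real, Real.norm_of_nonneg pi_pos.le,
      Real.norm_of_nonneg hx.1.le]
    exact mul_le_of_le_one_right (by positivity) hx.2.le
  have hb1 : ‖(π : ℂ) * κ * x‖ ≤ 1 := by
    nlinarith [pi_le_four, norm_nonneg κ, pi_pos]
  have harg : (π : ℂ) * (n - 1 / 2 + κ) * x =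
      ((π * ((n : ℝ) - 1 / 2) * x : ℝ) : ℂ) + π * κ * x := by
    push_cast; ring
  rw [← mul_pow]
  rcases hν with rfl | rfl
  · set q : ℂ := n - 1 / 2 + κ with hq
    have hqn : (n : ℝ) / 4 ≤ ‖q‖ := by
      have h1 : ‖(n : ℂ)‖ ≤ ‖q‖ + ‖(1 / 2 : ℂ)‖ + ‖κ‖ := by
        have : (n : ℂ) = q + 1 / 2 - κ := by rw [hq]; ring
        conv_lhs => rw [this]
        exact (norm_sub_le _ _).trans (by gcongr; exact norm_add_le _ _)
      have h2 : ‖(1 / 2 : ℂ)‖ = 1 / 2 := by norm_num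
      rw [Complex.norm_natCast, h2] at h1
      linarith
    have hq0 : q ≠ 0 := norm_pos_iff.1 (by linarith)
    set a : ℝ := π * ((n : ℝ) - 1 / 2) * x with ha
    have hsin := Complex.norm_sin_ofReal_add_sub_le a hb1
    have hS : Slam 0 x (((π : ℂ) * q) ^ 2) = Complex.sin (a + π * κ * x) / (π * q) := by
      rw [eq_div_iff (mul_ne_zero hπ hq0), mul_comm, mul_Slam_zero_sq, harg]
    have hh : (halfTrig 0 n x : ℂ) = Complex.sin a := by
      simp [halfTrig, ha]
    have heq : (n : ℂ) ^ (1 - 0) * Slam 0 x (((π : ℂ) * q) ^ 2) -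
        (1 / π : ℂ) ^ (1 - 0) * halfTrig 0 n x =
        (1 / π) * ((n / q) * (Complex.sin (a + π * κ * x) - Complex.sin a) +
          (1 / 2 - κ) / q * Complex.sin a) := by
      rw [hS, hh, Nat.sub_zero, pow_one, pow_one]
      have : (1 / 2 - κ : ℂ) = n - q := by rw [hq]; ring
      rw [this]
      field_simp
      ring
    have hnq : ‖(n : ℂ) / q‖ ≤ 4 := by
      rw [norm_div, Complex.norm_natCast, div_le_iff₀ (by linarith)]
      linarith
    have hκq : ‖(1 / 2 - κ : ℂ) / q‖ ≤ 3 / n := by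
      have h1 : ‖(1 / 2 - κ : ℂ)‖ ≤ 3 / 4 := by
        refine (norm_sub_le _ _).trans ?_
        have h2 : ‖(1 / 2 : ℂ)‖ = 1 / 2 := by norm_num
        rw [h2]; linarith
      rw [norm_div, div_le_div_iff₀ (by linarith) (by linarith)]
      nlinarith
    have hsa : ‖Complex.sin a‖ ≤ 1 := by
      rw [← Complex.ofReal_sin, Complex.norm_real]
      exact abs_sin_le_one a
    rw [heq, norm_mul, norm_div, norm_one, Complex.norm_real, Real.norm_of_nonneg pi_pos.le,
      one_div_mul_eq_div, div_le_iff₀ pi_pos]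
    refine (norm_add_le _ _).trans ?_
    rw [norm_mul, norm_mul]
    have h1 := mul_le_mul hnq (hsin.trans (mul_le_mul_of_nonneg_left hb zero_le_four))
      (norm_nonneg _) zero_le_four
    have h2 := mul_le_mul hκq hsa (norm_nonneg _) (by positivity)
    have h3 : 3 / (n : ℝ) ≤ 1 / n * π := by
      rw [one_div_mul_eq_div]
      gcongr
      exact pi_gt_three.le
    linarith
  · have hcos := Complex.norm_cos_ofReal_add_sub_le (π * ((n : ℝ) - 1 / 2) * x) hb1
    rw [Slam_one_sq, harg, Nat.sub_self, pow_zero, pow_zero, one_mul, one_mul]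
    have hh : (halfTrig 1 n x : ℂ) = Complex.cos ((π * ((n : ℝ) - 1 / 2) * x : ℝ) : ℂ) := by
      simp [halfTrig]
    rw [hh]
    have : 0 ≤ 1 / (n : ℝ) := by positivity
    nlinarith [pi_le_four, norm_nonneg κ]

theorem norm_smul_slamLp_sub_le {ν n : ℕ} (hν : ν = 0 ∨ ν = 1) (hn : 1 ≤ n) {κ : ℂ}
    (hκ : ‖κ‖ ≤ 1 / 4) :
    ‖(n : ℂ) ^ (1 - ν) • slamLp ν ((π : ℂ) ^ 2 * (n - 1 / 2 + κ) ^ 2) -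
      ((1 / π : ℂ) ^ (1 - ν) / (√2 : ℂ)) • halfTrigLp ν n‖ ≤ 16 * ‖κ‖ + 1 / n := by
  have hu : measureUnivNNReal volumeIoo = 1 := by simp [measureUnivNNReal]
  have h2 : (√2 : ℂ) ≠ 0 := by simp
  have := Lp.norm_le_of_ae_bound (f := (n : ℂ) ^ (1 - ν) •
      slamLp ν ((π : ℂ) ^ 2 * (n - 1 / 2 + κ) ^ 2) -
      ((1 / π : ℂ) ^ (1 - ν) / (√2 : ℂ)) • halfTrigLp ν n)
      (C := 16 * ‖κ‖ + 1 / n) (by positivity) <| by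
    filter_upwards [Lp.coeFn_sub ((n : ℂ) ^ (1 - ν) •
      slamLp ν ((π : ℂ) ^ 2 * (n - 1 / 2 + κ) ^ 2))
      (((1 / π : ℂ) ^ (1 - ν) / (√2 : ℂ)) • halfTrigLp ν n),
      Lp.coeFn_smul ((n : ℂ) ^ (1 - ν)) (slamLp ν ((π : ℂ) ^ 2 * (n - 1 / 2 + κ) ^ 2)),
      Lp.coeFn_smul ((1 / π : ℂ) ^ (1 - ν) / (√2 : ℂ)) (halfTrigLp ν n),
      coeFn_halfTrigLp hν n, coeFn_slamLp ν ((π : ℂ) ^ 2 * (n - 1 / 2 + κ) ^ 2),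
      ae_restrict_mem measurableSet_Ioo] with x e1 e2 e3 e4 e5 hx
    rw [e1, Pi.sub_apply, e2, e3, Pi.smul_apply, Pi.smul_apply, e4, e5, smul_eq_mul, smul_eq_mul,
      Complex.ofReal_mul, ← mul_assoc (_ / _), div_mul_cancel₀ _ h2]
    exact norm_natCast_mul_Slam_sub_le hν hn hκ hx
  simpa [hu] using this

theorem sq_ne_sq_of_norm_lt {n : ℕ} (hn : 1 ≤ n) {a b : ℂ} (ha : ‖a‖ < 1 / 4) (hb : ‖b‖ < 1 / 4) :
    ((n : ℂ) - 1 / 2 + a) ^ 2 ≠ (((n + 1 : ℕ) : ℂ) - 1 / 2 + b) ^ 2 := by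
  have hn' : (1 : ℝ) ≤ n := by exact_mod_cast hn
  have ha' := abs_lt.1 ((Complex.abs_re_le_norm a).trans_lt ha)
  have hb' := abs_lt.1 ((Complex.abs_re_le_norm b).trans_lt hb)
  intro h
  rcases sq_eq_sq_iff_eq_or_eq_neg.1 h with h | h
  · have := congrArg Complex.re h
    simp at this
    linarith [ha'.1, ha'.2, hb'.1, hb'.2]
  · have := congrArg Complex.re h
    simp at this
    linarith [ha'.1, ha'.2, hb'.1, hb'.2]

end Asymptotics

section Blocks

variable {α : Type*} {ξ : ℕ → α} {kk : ℕ → ℕ}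

theorem blockStart_spec (hkk : ∀ n : ℕ, 1 ≤ n → kk n = sInf {j : ℕ | 1 ≤ j ∧ ξ j = ξ n})
    {n : ℕ} (hn : 1 ≤ n) :
    1 ≤ kk n ∧ kk n ≤ n ∧ ξ (kk n) = ξ n ∧ ∀ j, 1 ≤ j → ξ j = ξ n → kk n ≤ j := by
  have hmem : n ∈ {j : ℕ | 1 ≤ j ∧ ξ j = ξ n} := ⟨hn, rfl⟩
  have h := Nat.sInf_mem ⟨n, hmem⟩
  rw [hkk n hn]
  exact ⟨h.1, Nat.sInf_le hmem, h.2, fun j hj he => Nat.sInf_le ⟨hj, he⟩⟩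

theorem blockStart_succ_eq (hnbr : ∀ j k n : ℕ, 1 ≤ j → j ≤ k → k ≤ n → ξ j = ξ n → ξ k = ξ n)
    (hkk : ∀ n : ℕ, 1 ≤ n → kk n = sInf {j : ℕ | 1 ≤ j ∧ ξ j = ξ n}) {n : ℕ}
    (h : ξ n ≠ ξ (n + 1)) : kk (n + 1) = n + 1 := by
  obtain ⟨h1, h2, h3, -⟩ := blockStart_spec hkk (Nat.le_add_left 1 n)
  by_contra hne
  exact h (hnbr (kk (n + 1)) n (n + 1) h1 (by omega) (by omega) h3)

end Blocks

section Zeros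

open scoped InnerProductSpace

theorem analyticOrderAt_prod_sub (s : Finset ℕ) (a : ℕ → ℂ) (z : ℂ) :
    analyticOrderAt (fun w => ∏ l ∈ s, (w - a l)) z = (s.filter fun l => a l = z).card := by
  induction s using Finset.induction_on with
  | empty =>
    simp only [Finset.prod_empty, Finset.filter_empty, Finset.card_empty, Nat.cast_zero]
    exact analyticOrderAt_eq_zero.2 (Or.inr one_ne_zero)
  | insert i s hi ih =>
    have h : (fun w => ∏ l ∈ insert i s, (w - a l)) =
        (fun w => w - a i) * fun w => ∏ l ∈ s, (w - a l) := by
      ext w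
      rw [Finset.prod_insert hi, Pi.mul_apply]
    rw [h, analyticOrderAt_mul (by fun_prop) (Differentiable.analyticAt (by fun_prop) z), ih,
      Finset.filter_insert]
    split_ifs with hz
    · rw [hz, analyticOrderAt_id_sub_const_self,
        Finset.card_insert_of_notMem fun hm => hi (Finset.mem_filter.1 hm).1]
      push_cast
      exact add_comm _ _
    · rw [analyticOrderAt_id_sub_const_of_ne (Ne.symm hz), zero_add]

theorem apply_eq_zero_of_mul_prod_sub_eq {G K : ℂ → ℂ} (hG : Differentiable ℂ G) {s : Finset ℕ}
    {a : ℕ → ℂ} (h : ∀ w, G w * ∏ l ∈ s, (w - a l) = K w) {z : ℂ}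
    (hz : ((s.filter fun l => a l = z).card : ℕ∞) + 1 ≤ analyticOrderAt K z) : G z = 0 := by
  have hK : K = G * fun w => ∏ l ∈ s, (w - a l) := funext fun w => (h w).symm
  rw [hK, analyticOrderAt_mul (hG.analyticAt z) (Differentiable.analyticAt (by fun_prop) z),
    analyticOrderAt_prod_sub, add_comm, ENat.add_le_add_iff_right (ENat.natCast_ne_top _)] at hz
  exact (analyticOrderAt_ne_zero.1 (Order.one_le_iff_ne_zero.1 hz)).2

theorem card_filter_le_analyticOrderAt {ξ : ℕ → ℂ} {kk : ℕ → ℕ}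
    (hnbr : ∀ j k n : ℕ, 1 ≤ j → j ≤ k → k ≤ n → ξ j = ξ n → ξ k = ξ n)
    (hkk : ∀ n : ℕ, 1 ≤ n → kk n = sInf {j : ℕ | 1 ≤ j ∧ ξ j = ξ n})
    {F : ℂ → ℂ} (hF : Differentiable ℂ F)
    (h : ∀ n, 1 ≤ n → iteratedDeriv (n - kk n) F (ξ n) = 0) (M : ℕ) (z : ℂ) :
    (((Finset.Icc 1 M).filter fun l => ξ l = z).card : ℕ∞) ≤ analyticOrderAt F z := by
  set A := (Finset.Icc 1 M).filter fun l => ξ l = z with hA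
  rcases A.eq_empty_or_nonempty with hA0 | hne
  · simp [hA0]
  obtain ⟨hm, hmz⟩ := Finset.mem_filter.1 (A.max'_mem hne)
  set m := A.max' hne
  have hm1 := (Finset.mem_Icc.1 hm).1
  obtain ⟨h1, h2, h3, h4⟩ := blockStart_spec hkk hm1
  have hsub : A ⊆ Finset.Icc (kk m) m := fun l hl => by
    obtain ⟨hl1, hl2⟩ := Finset.mem_filter.1 hl
    exact Finset.mem_Icc.2 ⟨h4 l (Finset.mem_Icc.1 hl1).1 (hl2.trans hmz.symm), A.le_max' l hl⟩
  rw [natCast_le_analyticOrderAt_iff_iteratedDeriv_eq_zero (hF.analyticAt z)]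
  intro i hi
  have hcard := Finset.card_le_card hsub
  rw [Nat.card_Icc] at hcard
  have hξ : ξ (kk m + i) = ξ m := hnbr (kk m) _ m h1 (by omega) (by omega) h3
  have hki : kk (kk m + i) = kk m := by rw [hkk (kk m + i) (by omega), hξ, ← hkk m hm1]
  have := h (kk m + i) (by omega)
  rwa [hki, hξ, hmz, Nat.add_sub_cancel_left] at this

theorem differentiable_inner_slamLp (ν : ℕ) (f : Lp ℂ 2 volumeIoo) :
    Differentiable ℂ fun lam => ⟪f, slamLp ν lam⟫_ℂ :=
  (innerSL ℂ f).differentiable.comp (differentiable_slamLp ν)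

theorem iteratedDeriv_inner_slamLp (ν m : ℕ) (f : Lp ℂ 2 volumeIoo) (z : ℂ) :
    iteratedDeriv m (fun lam => ⟪f, slamLp ν lam⟫_ℂ) z = ⟪f, iteratedDeriv m (slamLp ν) z⟫_ℂ :=
  (innerSL ℂ f).iteratedDeriv_comp_left (differentiable_slamLp ν).contDiff.contDiffAt

/-- Finitely many zeros of `λ ↦ ⟪f, S_ν(·,λ)⟫` may be moved to prescribed positions. -/
theorem exists_inner_slamLp_mul_prod_eq {ν : ℕ} (hν : ν = 0 ∨ ν = 1) {a : ℕ → ℂ}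
    {f : Lp ℂ 2 volumeIoo} (hf : ∀ M z, (((Finset.Icc 1 M).filter fun l => a l = z).card : ℕ∞) ≤
      analyticOrderAt (fun lam => ⟪f, slamLp ν lam⟫_ℂ) z) (b : ℕ → ℂ) (N : ℕ) :
    ∃ g : Lp ℂ 2 volumeIoo, ∀ lam, ⟪g, slamLp ν lam⟫_ℂ * ∏ l ∈ Finset.Icc 1 N, (lam - a l) =
      ⟪f, slamLp ν lam⟫_ℂ * ∏ l ∈ Finset.Icc 1 N, (lam - b l) := by
  induction N with
  | zero => exact ⟨f, fun lam => by simp⟩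
  | succ N ih =>
    obtain ⟨g, hg⟩ := ih
    have hzero : ⟪g, slamLp ν (a (N + 1))⟫_ℂ = 0 := by
      refine apply_eq_zero_of_mul_prod_sub_eq (differentiable_inner_slamLp ν g) hg ?_
      have hmul := analyticOrderAt_mul
        ((differentiable_inner_slamLp ν f).analyticAt (a (N + 1)))
        (g := fun lam => ∏ l ∈ Finset.Icc 1 N, (lam - b l))
        (Differentiable.analyticAt (by fun_prop) _)
      refine le_trans ?_ (le_self_add.trans hmul.ge)
      refine le_trans ?_ (hf (N + 1) (a (N + 1)))
      rw [← Finset.insert_Icc_right_eq_Icc_add_one (by omega), Finset.filter_insert, if_pos rfl,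
        Finset.card_insert_of_notMem (by simp)]
      push_cast
      exact le_rfl
    obtain ⟨k, hk⟩ := exists_inner_slamLp_divided_difference hν g (a (N + 1))
    refine ⟨g + (starRingEnd ℂ) (a (N + 1) - b (N + 1)) • k, fun lam => ?_⟩
    have h1 := hk lam
    rw [hzero, sub_zero] at h1
    rw [Finset.prod_Icc_succ_top (by omega), Finset.prod_Icc_succ_top (by omega), inner_add_left,
      inner_smul_left, Complex.conj_conj]
    linear_combination (lam - b (N + 1)) * hg lam +
      (∏ l ∈ Finset.Icc 1 N, (lam - a l)) * (a (N + 1) - b (N + 1)) * h1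

end Zeros

section RieszBasis

open scoped InnerProductSpace

theorem HilbertBasis.eq_zero_of_inner_eq_zero_of_tsum_lt {H : Type*} [NormedAddCommGroup H]
    [InnerProductSpace ℂ H] (e : HilbertBasis {n : ℕ // 1 ≤ n} ℂ H) {d : ℕ → H} {c : ℂ} {N : ℕ}
    (hsum : Summable fun n => ‖d n‖ ^ 2) (hlt : ∑' k, ‖d (k + N)‖ ^ 2 < ‖c‖ ^ 2) {g : H}
    (hlow : ∀ n : {n : ℕ // 1 ≤ n}, n.1 ≤ N → ⟪e n, g⟫_ℂ = 0)
    (hhigh : ∀ n : {n : ℕ // 1 ≤ n}, N < n.1 → ⟪d n + c • e n, g⟫_ℂ = 0) : g = 0 := by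
  set w : ℕ → H := fun n => if n ≤ N then 0 else d n with hw
  have hwle : ∀ n, ‖w n‖ ^ 2 ≤ ‖d n‖ ^ 2 := fun n => by
    simp only [hw]
    split_ifs
    · simp
    · exact le_rfl
  have hws : Summable fun n => ‖w n‖ ^ 2 := hsum.of_nonneg_of_le (fun n => by positivity) hwle
  have hwlt : ∑' n : {n : ℕ // 1 ≤ n}, ‖w n‖ ^ 2 < ‖c‖ ^ 2 := by
    refine lt_of_le_of_lt (tsum_comp_le_tsum_of_inj hws (fun n => by positivity)
      Subtype.val_injective) (lt_of_le_of_lt ?_ hlt)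
    rw [← hws.sum_add_tsum_nat_add N, Finset.sum_eq_zero fun i hi => by
      simp [hw, (Finset.mem_range.1 hi).le], zero_add]
    exact Summable.tsum_le_tsum (fun k => hwle _) ((summable_nat_add_iff N).2 hws)
      ((summable_nat_add_iff N).2 hsum)
  have hnorm := e.norm_sq_le_of_inner_eq (w := fun n => w n)
    (hws.comp_injective Subtype.val_injective) (f := g) (g := (starRingEnd ℂ) c • g) fun n => by
      rw [inner_smul_right]
      by_cases hn : n.1 ≤ N
      · rw [hlow n hn]
        simp [hw, hn]
      · have h := hhigh n (not_le.1 hn)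
        rw [inner_add_left, inner_smul_left, ← eq_neg_iff_add_eq_zero] at h
        simp only [hw, if_neg hn, h, norm_neg]
  rw [norm_smul, mul_pow, RCLike.norm_conj] at hnorm
  by_contra hne
  exact (mul_lt_mul_of_pos_right hwlt (by positivity : 0 < ‖g‖ ^ 2)).not_ge hnorm

theorem eq_zero_of_inner_iteratedDeriv_slamLp_eq_zero {ν : ℕ} (hν : ν = 0 ∨ ν = 1) {ξ : ℕ → ℂ}
    {kk : ℕ → ℕ} (hnbr : ∀ j k n : ℕ, 1 ≤ j → j ≤ k → k ≤ n → ξ j = ξ n → ξ k = ξ n)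
    (hkk : ∀ n : ℕ, 1 ≤ n → kk n = sInf {j : ℕ | 1 ≤ j ∧ ξ j = ξ n})
    (hsimple : ∀ᶠ n in Filter.atTop, kk n = n) {c : ℂ} (hc : c ≠ 0)
    (hsum : Summable fun n : ℕ =>
      ‖(n : ℂ) ^ (1 - ν) • slamLp ν (ξ n) - c • halfTrigLp ν n‖ ^ 2)
    {f : Lp ℂ 2 volumeIoo}
    (hf : ∀ n, 1 ≤ n → ⟪f, iteratedDeriv (n - kk n) (slamLp ν) (ξ n)⟫_ℂ = 0) : f = 0 := by
  set d : ℕ → Lp ℂ 2 volumeIoo :=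
    fun n => (n : ℂ) ^ (1 - ν) • slamLp ν (ξ n) - c • halfTrigLp ν n with hd
  set b : ℕ → ℂ := fun n => (π : ℂ) ^ 2 * (n - 1 / 2) ^ 2 with hb
  have hord := card_filter_le_analyticOrderAt hnbr hkk (differentiable_inner_slamLp ν f)
    fun n hn => (iteratedDeriv_inner_slamLp ν _ f _).trans (hf n hn)
  obtain ⟨N, hN, hNsum⟩ : ∃ N, (∀ n, N ≤ n → kk n = n) ∧ ∑' k, ‖d (k + N)‖ ^ 2 < ‖c‖ ^ 2 := by
    obtain ⟨N₀, hN₀⟩ := Filter.eventually_atTop.1 hsimple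
    have h := (tendsto_sum_nat_add fun n => ‖d n‖ ^ 2).eventually_lt_const
      (show (0 : ℝ) < ‖c‖ ^ 2 by positivity)
    obtain ⟨N, h1, h2⟩ := (h.and (Filter.eventually_ge_atTop N₀)).exists
    exact ⟨N, fun n hn => hN₀ n (h2.trans hn), h1⟩
  obtain ⟨g, hg⟩ := exists_inner_slamLp_mul_prod_eq hν hord b N
  have hmul : ∀ z, analyticOrderAt
      (fun lam => ⟪f, slamLp ν lam⟫_ℂ * ∏ l ∈ Finset.Icc 1 N, (lam - b l)) z =
      analyticOrderAt (fun lam => ⟪f, slamLp ν lam⟫_ℂ) z +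
        ((Finset.Icc 1 N).filter fun l => b l = z).card := fun z => by
    rw [← analyticOrderAt_prod_sub]
    exact analyticOrderAt_mul ((differentiable_inner_slamLp ν f).analyticAt z)
      (Differentiable.analyticAt (by fun_prop) z)
  have hlow : ∀ n, 1 ≤ n → n ≤ N → ⟪g, slamLp ν (b n)⟫_ℂ = 0 := fun n h1 hn => by
    refine apply_eq_zero_of_mul_prod_sub_eq (differentiable_inner_slamLp ν g) hg ?_
    rw [hmul]
    refine add_le_add (hord N _) ?_
    have hpos : 1 ≤ ((Finset.Icc 1 N).filter fun l => b l = b n).card :=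
      Finset.card_pos.2 ⟨n, Finset.mem_filter.2 ⟨Finset.mem_Icc.2 ⟨h1, hn⟩, rfl⟩⟩
    exact_mod_cast hpos
  have hhigh : ∀ n, N < n → ⟪g, slamLp ν (ξ n)⟫_ℂ = 0 := fun n hn => by
    refine apply_eq_zero_of_mul_prod_sub_eq (differentiable_inner_slamLp ν g) hg ?_
    rw [hmul]
    refine le_trans ?_ ((hord n (ξ n)).trans le_self_add)
    have hlt : (Finset.Icc 1 N).filter (fun l => ξ l = ξ n) ⊂
        (Finset.Icc 1 n).filter (fun l => ξ l = ξ n) := by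
      refine Finset.ssubset_iff_subset_ne.2 ⟨Finset.filter_subset_filter _
        (Finset.Icc_subset_Icc_right hn.le), fun h => ?_⟩
      have hmem : n ∈ (Finset.Icc 1 n).filter (fun l => ξ l = ξ n) :=
        Finset.mem_filter.2 ⟨Finset.mem_Icc.2 ⟨by omega, le_rfl⟩, rfl⟩
      rw [← h, Finset.mem_filter, Finset.mem_Icc] at hmem
      omega
    exact_mod_cast Finset.card_lt_card hlt
  obtain ⟨e, he⟩ := exists_hilbertBasis_halfTrigLp hν
  have hg0 : g = 0 := by
    refine e.eq_zero_of_inner_eq_zero_of_tsum_lt hsum hNsum (fun n hn => ?_) fun n hn => ?_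
    · rw [he, ← inner_conj_symm, halfTrigLp, inner_smul_right, hlow n n.2 hn, mul_zero, map_zero]
    · rw [he, sub_add_cancel, ← inner_conj_symm, inner_smul_right, hhigh n hn, mul_zero, map_zero]
  have hF : ∀ z, ⟪f, slamLp ν z⟫_ℂ = 0 := fun z => by
    refine apply_eq_zero_of_mul_prod_sub_eq (differentiable_inner_slamLp ν f)
      (s := Finset.Icc 1 N) (a := b) (K := fun _ => 0) (fun lam => ?_) ?_
    · rw [← hg lam, hg0, inner_zero_left, zero_mul]
    · rw [analyticOrderAt_eq_top.2 (Filter.Eventually.of_forall fun _ => rfl)]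
      exact le_top
  refine eq_zero_of_inner_halfTrigLp_eq_zero hν fun n hn => ?_
  rw [← inner_conj_symm, halfTrigLp, inner_smul_right, hF, mul_zero, map_zero]

end RieszBasis

/-- **Lemma 4.** Let `ξ_n = π²(n − 1/2 + κ_n)²` with `(κ_n) ∈ l²`, with all repetitions
among the `ξ_n` neighboring, `kk n` the least index of the block of `n`, and
`s_{k+s}(x) = k^{1−ν} (∂^s/∂λ^s) S_ν(x,λ)|_{λ=ξ_k}` for `k ∈ S`, `s = 0,…,m_k−1`
(equivalently `s_n(x) = (kk n)^{1−ν} (∂^{n−kk n}/∂λ^{n−kk n}) S_ν(x,λ)|_{λ=ξ_n}`).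
Then `(s_n)_{n≥1}` is a Riesz basis of `L²((0,1),ℂ)`: the image of an orthonormal basis
under a continuous linear equivalence. -/
theorem riesz_basis_of_sine_type_zeros
    (ν : ℕ) (hν : ν = 0 ∨ ν = 1)
    (κ : ℕ → ℂ) (hκ : Summable (fun n => ‖κ n‖ ^ 2))
    (ξ : ℕ → ℂ) (hξ : ∀ n : ℕ, 1 ≤ n → ξ n = (π : ℂ) ^ 2 * ((n : ℂ) - 1 / 2 + κ n) ^ 2)
    (hfin : ∀ n : ℕ, 1 ≤ n → {j : ℕ | 1 ≤ j ∧ ξ j = ξ n}.Finite)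
    (hnbr : ∀ j k n : ℕ, 1 ≤ j → j ≤ k → k ≤ n → ξ j = ξ n → ξ k = ξ n)
    (kk : ℕ → ℕ) (hkk : ∀ n : ℕ, 1 ≤ n → kk n = sInf {j : ℕ | 1 ≤ j ∧ ξ j = ξ n})
    (s : ℕ → ℝ → ℂ)
    (hs : ∀ n : ℕ, 1 ≤ n → s n =
      fun x : ℝ => (kk n : ℂ) ^ (1 - ν) * iteratedDeriv (n - kk n) (fun lam => Slam ν x lam) (ξ n)) :
    ∃ (e : {n : ℕ // 1 ≤ n} → Lp ℂ 2 (volume.restrict (Ioo (0 : ℝ) 1)))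
      (T : Lp ℂ 2 (volume.restrict (Ioo (0 : ℝ) 1)) ≃L[ℂ] Lp ℂ 2 (volume.restrict (Ioo (0 : ℝ) 1))),
      Orthonormal ℂ e
      ∧ (Submodule.span ℂ (Set.range e)).topologicalClosure = ⊤
      ∧ ∀ n : {n : ℕ // 1 ≤ n},
          (T (e n) : ℝ → ℂ) =ᵐ[volume.restrict (Ioo (0 : ℝ) 1)] s n := by
  obtain ⟨e, he⟩ := exists_hilbertBasis_halfTrigLp hν
  set c : ℂ := (1 / π : ℂ) ^ (1 - ν) / (√2 : ℂ) with hc_def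
  have hc : c ≠ 0 := by simp [hc_def, pi_ne_zero]
  set v : ℕ → Lp ℂ 2 volumeIoo :=
    fun n => (kk n : ℂ) ^ (1 - ν) • iteratedDeriv (n - kk n) (slamLp ν) (ξ n) with hv
  have hsmall : ∀ᶠ n in Filter.atTop, ‖κ n‖ < 1 / 4 := by
    filter_upwards [hκ.tendsto_atTop_zero.eventually_lt_const
      (show (0 : ℝ) < (1 / 4) ^ 2 by norm_num)] with n hn
    exact lt_of_pow_lt_pow_left₀ 2 (by norm_num) hn
  have hsimple : ∀ᶠ n in Filter.atTop, kk n = n := by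
    obtain ⟨N, hN⟩ := Filter.eventually_atTop.1 hsmall
    filter_upwards [Filter.eventually_ge_atTop (N + 2)] with n hn
    obtain ⟨m, rfl⟩ : ∃ m, n = m + 1 := ⟨n - 1, by omega⟩
    refine blockStart_succ_eq hnbr hkk fun h => ?_
    rw [hξ m (by omega), hξ (m + 1) (by omega)] at h
    refine sq_ne_sq_of_norm_lt (by omega) (hN m (by omega)) (hN (m + 1) (by omega))
      (mul_left_cancel₀ ?_ h)
    exact pow_ne_zero 2 (by exact_mod_cast pi_ne_zero)
  have hsum : Summable fun n : ℕ =>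
      ‖(n : ℂ) ^ (1 - ν) • slamLp ν (ξ n) - c • halfTrigLp ν n‖ ^ 2 := by
    have hbound : Summable fun n : ℕ => 2 * (16 ^ 2 * ‖κ n‖ ^ 2 + 1 / (n : ℝ) ^ 2) :=
      ((hκ.mul_left _).add (Real.summable_one_div_nat_pow.2 one_lt_two)).mul_left 2
    refine hbound.of_norm_bounded_eventually_nat ?_
    filter_upwards [hsmall, Filter.eventually_ge_atTop 1] with n hn h1
    have h := norm_smul_slamLp_sub_le hν h1 hn.le
    rw [← hξ n h1] at h
    rw [Real.norm_of_nonneg (by positivity)]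
    refine (pow_le_pow_left₀ (norm_nonneg _) h 2).trans (add_sq_le.trans_eq ?_)
    rw [mul_pow, div_pow, one_pow]
  have hvsum : Summable fun n => ‖v n - c • halfTrigLp ν n‖ ^ 2 := by
    refine hsum.congr_atTop ?_
    filter_upwards [hsimple] with n hn
    simp only [hv, hn, Nat.sub_self, iteratedDeriv_zero]
  obtain ⟨T, hT⟩ := e.exists_equiv_of_summable_norm_sub_sq (v := fun n => v n) hc
    (by simpa only [he] using! hvsum.comp_injective Subtype.val_injective) fun f hf =>
      eq_zero_of_inner_iteratedDeriv_slamLp_eq_zero hν hnbr hkk hsimple hc hsum fun n hn => by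
        have h := hf ⟨n, hn⟩
        have hk : (kk n : ℂ) ^ (1 - ν) ≠ 0 :=
          pow_ne_zero _ (Nat.cast_ne_zero.2 (by have := (blockStart_spec hkk hn).1; omega))
        rw [← inner_conj_symm, map_eq_zero, hv, inner_smul_right] at h
        exact (mul_eq_zero.1 h).resolve_left hk
  refine ⟨e, T, e.orthonormal, e.dense_span, fun n => ?_⟩
  rw [hT, hs n n.2]
  filter_upwards [Lp.coeFn_smul ((kk n : ℂ) ^ (1 - ν))
    (iteratedDeriv (n - kk n) (slamLp ν) (ξ n)),
    coeFn_iteratedDeriv_slamLp ν (n - kk n) (ξ n)] with x h1 h2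
  rw [hv, h1, Pi.smul_apply, h2, smul_eq_mul]
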